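/- Let k be a field and let R be a unital associative prime k-algebra whose extended centroid is algebraic over k, in the following concrete sense: for every nonzero two-sided ideal I of R and every k-linear map f : I → R satisfying f(r x) = r f(x) and f(x r) = f(x) r for all r ∈ R and x ∈ I, there exist n ≥ 1 and scalars c_0, …, c_n ∈ k, not all zero, such that Σ_{i=0}^{n} c_i f^{i}(x_1 x_2 ⋯ x_n) = 0 for all x_1, …, x_n ∈ I (where f^{i} is the i-fold iterate of f, well defined on such products since f(x y) = f(x) y ∈ I for x, y ∈ I). Let V be a nonzero finite-dimensional k-subspace of R. Then there exists a nonzero element r ∈ R such that r ∈ I for every two-sided ideal I of R with I ∩ V ≠ (0). -/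

import Mathlib

/-- The extended centroid of the prime ring `R` is algebraic over `k`, expressed
concretely: every `(R,R)`-bimodule homomorphism `f` from a nonzero two-sided ideal
`I` to `R` (encoded as a function `R → R` which is `k`-linear and a bimodule map on
`I`; every such partial map extends to such a function) satisfies a nontrivial
polynomial relation over `k` on products of elements of `I`. -/
def ExtCentroidAlgebraic (k : Type) [Field k] (R : Type) [Ring R] [Algebra k R] : Prop :=
  ∀ I : TwoSidedIdeal R, I ≠ ⊥ →
    ∀ f : R → R,
      (∀ x ∈ I, ∀ y ∈ I, f (x + y) = f x + f y) →
      (∀ (c : k) (x : R), x ∈ I → f (c • x) = c • f x) →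
      (∀ (r x : R), x ∈ I → f (r * x) = r * f x) →
      (∀ (r x : R), x ∈ I → f (x * r) = f x * r) →
      ∃ (n : ℕ) (c : Fin (n + 1) → k), 1 ≤ n ∧ (∃ i, c i ≠ 0) ∧
        ∀ x : Fin n → R, (∀ j, x j ∈ I) →
          ∑ i : Fin (n + 1), c i • f^[(i : ℕ)] (List.ofFn x).prod = 0

namespace ExtCent

variable {k : Type} [Field k] {R : Type} [Ring R] [Algebra k R]

/-- Primeness of a ring, in elementwise form. -/
def IsPr (R : Type) [Ring R] : Prop :=
  ∀ a b : R, (∀ x : R, a * x * b = 0) → a = 0 ∨ b = 0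

/-- A two-sided ideal with a nonzero element. -/
def NZ (I : TwoSidedIdeal R) : Prop := ∃ x ∈ I, x ≠ 0

/-- `f` is a bimodule homomorphism on `I`. -/
def HomOn (I : TwoSidedIdeal R) (f : Module.End k R) : Prop :=
  ∀ x ∈ I, ∀ r : R, f (r * x) = r * f x ∧ f (x * r) = f x * r

lemma IsPr.ex (hp : IsPr R) {a b : R} (ha : a ≠ 0) (hb : b ≠ 0) : ∃ x, a * x * b ≠ 0 := by
  by_contra h
  push Not at h
  rcases hp a b h with h | h
  · exact ha h
  · exact hb h

lemma NZ.inf (hp : IsPr R) {I J : TwoSidedIdeal R} (hI : NZ I) (hJ : NZ J) : NZ (I ⊓ J) := by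
  obtain ⟨a, ha, ha0⟩ := hI
  obtain ⟨b, hb, hb0⟩ := hJ
  obtain ⟨x, hx⟩ := hp.ex ha0 hb0
  refine ⟨a * x * b, ⟨?_, ?_⟩, hx⟩
  · exact I.mul_mem_right _ _ (I.mul_mem_right _ _ ha)
  · exact J.mul_mem_left _ _ hb

lemma HomOn.mono {I J : TwoSidedIdeal R} {f : Module.End k R} (h : HomOn I f)
    (hJ : ∀ x ∈ J, x ∈ I) : HomOn J f := fun x hx r => h x (hJ x hx) r

lemma HomOn.infl {I : TwoSidedIdeal R} {f : Module.End k R} (h : HomOn I f)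
    (J : TwoSidedIdeal R) : HomOn (I ⊓ J) f := h.mono fun _ hx => hx.1

lemma HomOn.infr {I : TwoSidedIdeal R} {f : Module.End k R} (h : HomOn I f)
    (J : TwoSidedIdeal R) : HomOn (J ⊓ I) f := h.mono fun _ hx => hx.2

lemma HomOn.rigid (hp : IsPr R) {I : TwoSidedIdeal R} {f : Module.End k R} (h : HomOn I f)
    {x : R} (hx : x ∈ I) (hx0 : x ≠ 0) (hfx : f x = 0) {y : R} (hy : y ∈ I) : f y = 0 := by
  by_contra h0
  obtain ⟨r, hr⟩ := hp.ex h0 hx0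
  apply hr
  rw [mul_assoc, ← (h y hy (r * x)).2, ← mul_assoc, (h x hx (y * r)).1, hfx, mul_zero]

lemma HomOn.add {I : TwoSidedIdeal R} {f g : Module.End k R} (hf : HomOn I f)
    (hg : HomOn I g) : HomOn I (f + g) := fun x hx r => by
  simp [(hf x hx r).1, (hf x hx r).2, (hg x hx r).1, (hg x hx r).2, mul_add, add_mul]

lemma HomOn.smul {I : TwoSidedIdeal R} {f : Module.End k R} (c : k) (hf : HomOn I f) :
    HomOn I (c • f) := fun x hx r => by
  simp [(hf x hx r).1, (hf x hx r).2]

lemma HomOn.sub {I : TwoSidedIdeal R} {f g : Module.End k R} (hf : HomOn I f)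
    (hg : HomOn I g) : HomOn I (f - g) := fun x hx r => by
  simp [(hf x hx r).1, (hf x hx r).2, (hg x hx r).1, (hg x hx r).2, mul_sub, sub_mul]

lemma HomOn.one (I : TwoSidedIdeal R) : HomOn I (1 : Module.End k R) := fun x hx r => by simp

/-- Domain of the composite. -/
def pull (I J : TwoSidedIdeal R) (g : Module.End k R) (hg : HomOn J g) : TwoSidedIdeal R :=
  TwoSidedIdeal.mk' {x | x ∈ J ∧ g x ∈ I}
    ⟨J.zero_mem, by simp⟩
    (fun hx hy => ⟨J.add_mem hx.1 hy.1, by simpa using I.add_mem hx.2 hy.2⟩)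
    (fun hx => ⟨J.neg_mem hx.1, by simpa using I.neg_mem hx.2⟩)
    (fun {x y} hy => ⟨J.mul_mem_left _ _ hy.1, by
      rw [(hg y hy.1 x).1]; exact I.mul_mem_left _ _ hy.2⟩)
    (fun {x y} hx => ⟨J.mul_mem_right _ _ hx.1, by
      rw [(hg x hx.1 y).2]; exact I.mul_mem_right _ _ hx.2⟩)

lemma mem_pull {I J : TwoSidedIdeal R} {g : Module.End k R} {hg : HomOn J g} {x : R} :
    x ∈ pull I J g hg ↔ x ∈ J ∧ g x ∈ I := by
  unfold pull
  rw [TwoSidedIdeal.mem_mk']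
  rfl

lemma NZ.pull (hp : IsPr R) {I J : TwoSidedIdeal R} (hI : NZ I) (hJ : NZ J)
    {g : Module.End k R} (hg : HomOn J g) : NZ (pull I J g hg) := by
  obtain ⟨a, ha, ha0⟩ := hJ
  obtain ⟨b, hb, hb0⟩ := hI
  obtain ⟨x, hx⟩ := hp.ex ha0 hb0
  refine ⟨a * x * b, mem_pull.2 ⟨?_, ?_⟩, hx⟩
  · exact J.mul_mem_right _ _ (J.mul_mem_right _ _ ha)
  · rw [(hg _ (J.mul_mem_right _ x ha) b).2]
    exact I.mul_mem_left _ _ hb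

lemma HomOn.mul {I J : TwoSidedIdeal R} {f g : Module.End k R} (hf : HomOn I f)
    (hg : HomOn J g) : HomOn (ExtCent.pull I J g hg) (f * g) := fun x hx r => by
  obtain ⟨h1, h2⟩ := mem_pull.1 hx
  simp [(hg x h1 r).1, (hg x h1 r).2, (hf _ h2 r).1, (hf _ h2 r).2]

lemma NZ.top [Nontrivial R] : NZ (⊤ : TwoSidedIdeal R) := ⟨1, trivial, one_ne_zero⟩

/-- The algebra of (total linear extensions of) partial bimodule homomorphisms. -/
def P (k : Type) [Field k] (R : Type) [Ring R] [Algebra k R] [Nontrivial R] (hp : IsPr R) :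
    Subalgebra k (Module.End k R) where
  carrier := {f | ∃ I, NZ I ∧ HomOn I f}
  mul_mem' := by
    rintro f g ⟨I, hI, hf⟩ ⟨J, hJ, hg⟩
    exact ⟨_, NZ.pull hp hI hJ hg, hf.mul hg⟩
  add_mem' := by
    rintro f g ⟨I, hI, hf⟩ ⟨J, hJ, hg⟩
    exact ⟨I ⊓ J, hI.inf hp hJ, (hf.infl J).add (hg.infr I)⟩
  algebraMap_mem' := by
    intro c
    refine ⟨⊤, NZ.top, ?_⟩
    rw [Algebra.algebraMap_eq_smul_one]
    exact (HomOn.one _).smul c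

lemma mem_P [Nontrivial R] {hp : IsPr R} {f : Module.End k R} :
    f ∈ P k R hp ↔ ∃ I, NZ I ∧ HomOn I f := Iff.rfl

/-- Ring congruences of a ring. -/
abbrev RC (A : Type) [Ring A] : Type := RingCon A

/-- Eventual equality. -/
def con (k : Type) [Field k] (R : Type) [Ring R] [Algebra k R] [Nontrivial R] (hp : IsPr R) :
    RC (P k R hp) where
  r f g := ∃ I, NZ I ∧ ∀ x ∈ I, f.1 x = g.1 x
  iseqv := by
    refine ⟨fun f => ⟨⊤, NZ.top, fun _ _ => rfl⟩, ?_, ?_⟩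
    · rintro f g ⟨I, hI, h⟩
      exact ⟨I, hI, fun x hx => (h x hx).symm⟩
    · rintro f g h ⟨I, hI, h1⟩ ⟨J, hJ, h2⟩
      exact ⟨I ⊓ J, hI.inf hp hJ, fun x hx => (h1 x hx.1).trans (h2 x hx.2)⟩
  add' := by
    rintro f f' g g' ⟨I, hI, h1⟩ ⟨J, hJ, h2⟩
    exact ⟨I ⊓ J, hI.inf hp hJ, fun x hx => by simp [h1 x hx.1, h2 x hx.2]⟩
  mul' := by
    rintro f f' g g' ⟨I, hI, h1⟩ ⟨J, hJ, h2⟩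
    obtain ⟨K, hK, hg⟩ := g.2
    refine ⟨J ⊓ pull I K _ hg, hJ.inf hp (hI.pull hp hK hg), fun x hx => ?_⟩
    have h34 : x ∈ pull I K g.1 hg := hx.2
    obtain ⟨h3, h4⟩ := mem_pull.1 h34
    change f.1 (g.1 x) = f'.1 (g'.1 x)
    rw [← h2 x hx.1, h1 _ h4]

/-- The extended centroid. -/
def C (k : Type) [Field k] (R : Type) [Ring R] [Algebra k R] [Nontrivial R] (hp : IsPr R) :
    Type := RingCon.Quotient (con k R hp)

noncomputable instance instRingC [Nontrivial R] (hp : IsPr R) : Ring (C k R hp) :=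
  inferInstanceAs (Ring (RingCon.Quotient (con k R hp)))

noncomputable instance instAlgC [Nontrivial R] (hp : IsPr R) : Algebra k (C k R hp) :=
  inferInstanceAs (Algebra k (RingCon.Quotient (con k R hp)))

/-- The quotient map. -/
noncomputable def π [Nontrivial R] (hp : IsPr R) : P k R hp →ₐ[k] C k R hp :=
  RingCon.mkₐ k (con k R hp)

lemma π_surj [Nontrivial R] (hp : IsPr R) : Function.Surjective (π (k := k) hp) :=
  RingCon.mk'_surjective _

lemma π_eq [Nontrivial R] {hp : IsPr R} {f g : P k R hp} :
    π hp f = π hp g ↔ ∃ I, NZ I ∧ ∀ x ∈ I, f.1 x = g.1 x :=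
  RingCon.eq (con k R hp)

lemma π_zero [Nontrivial R] {hp : IsPr R} {f : P k R hp} :
    π hp f = 0 ↔ ∃ I, NZ I ∧ ∀ x ∈ I, f.1 x = 0 := by
  rw [← map_zero (π hp), π_eq]
  rfl

/-- One-point criterion. -/
lemma π_zero_of [Nontrivial R] {hp : IsPr R} {f : P k R hp} {I : TwoSidedIdeal R}
    (hf : HomOn I f.1) {x : R} (hx : x ∈ I) (hx0 : x ≠ 0) (h : f.1 x = 0) : π hp f = 0 :=
  π_zero.2 ⟨I, ⟨x, hx, hx0⟩, fun _ hy => hf.rigid hp hx hx0 h hy⟩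

/-- If the class vanishes then the map vanishes on every domain. -/
lemma zero_of_π [Nontrivial R] {hp : IsPr R} {f : P k R hp} {I : TwoSidedIdeal R}
    (hf : HomOn I f.1) (h : π hp f = 0) {x : R} (hx : x ∈ I) : f.1 x = 0 := by
  by_cases hx0 : x = 0
  · simp [hx0]
  obtain ⟨J, hJ, hJ0⟩ := π_zero.1 h
  obtain ⟨y, hy, hy0⟩ := NZ.inf hp ⟨x, hx, hx0⟩ hJ
  exact hf.rigid hp hy.1 hy0 (hJ0 y hy.2) hx

lemma C_comm [Nontrivial R] (hp : IsPr R) (a b : C k R hp) : a * b = b * a := by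
  obtain ⟨f, rfl⟩ := π_surj hp a
  obtain ⟨g, rfl⟩ := π_surj hp b
  rw [← sub_eq_zero, ← map_mul, ← map_mul, ← map_sub]
  obtain ⟨I, hI, hf⟩ := f.2
  obtain ⟨J, hJ, hg⟩ := g.2
  obtain ⟨x, ⟨hxI, hxJ⟩, hx0⟩ := hI.inf hp hJ
  obtain ⟨r, hr⟩ := hp.ex hx0 hx0
  have hgx : g.1 (x * r * x) = x * r * g.1 x := (hg x hxJ (x * r)).1
  have hgx' : g.1 (x * r * x) = g.1 x * (r * x) := by rw [mul_assoc]; exact (hg x hxJ _).2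
  have hfx : f.1 (x * r * x) = f.1 x * (r * x) := by rw [mul_assoc]; exact (hf x hxI _).2
  have hfx' : f.1 (x * r * x) = x * r * f.1 x := (hf x hxI (x * r)).1
  have mI : x * r * x ∈ I := I.mul_mem_left _ _ hxI
  have mJ : x * r * x ∈ J := J.mul_mem_left _ _ hxJ
  have hfg : HomOn (pull I J g.1 hg ⊓ pull J I f.1 hf) ((f * g - g * f : P k R hp)).1 :=
    ((hf.mul hg).infl _).sub ((hg.mul hf).infr _)
  have m1 : x * r * x ∈ pull I J g.1 hg := by
    refine mem_pull.2 ⟨mJ, ?_⟩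
    rw [hgx, mul_assoc]; exact I.mul_mem_right _ _ hxI
  have m2 : x * r * x ∈ pull J I f.1 hf := by
    refine mem_pull.2 ⟨mI, ?_⟩
    rw [hfx', mul_assoc]; exact J.mul_mem_right _ _ hxJ
  refine π_zero_of hfg (x := x * r * x) ⟨m1, m2⟩ hr ?_
  · have e1 : f.1 (g.1 (x * r * x)) = f.1 x * (r * g.1 x) := by
      rw [hgx, mul_assoc]; exact (hf x hxI _).2
    have e2 : g.1 (f.1 (x * r * x)) = f.1 x * (r * g.1 x) := by
      rw [hfx, ← mul_assoc, (hg x hxJ _).1, mul_assoc]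
    change f.1 (g.1 (x * r * x)) - g.1 (f.1 (x * r * x)) = 0
    rw [e1, e2, sub_self]

noncomputable instance instCommRingC [Nontrivial R] (hp : IsPr R) : CommRing (C k R hp) :=
  { instRingC hp with mul_comm := C_comm hp }

instance [Nontrivial R] (hp : IsPr R) : Nontrivial (C k R hp) := by
  refine ⟨1, 0, ?_⟩
  rw [← map_one (π hp)]
  intro h
  obtain ⟨I, ⟨x, hx, hx0⟩, h⟩ := π_zero.1 h
  exact hx0 (h x hx)

instance [Nontrivial R] (hp : IsPr R) : NoZeroDivisors (C k R hp) := by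
  refine ⟨fun {a b} h => ?_⟩
  obtain ⟨f, rfl⟩ := π_surj hp a
  obtain ⟨g, rfl⟩ := π_surj hp b
  rw [← map_mul] at h
  obtain ⟨I, hI, hf⟩ := f.2
  obtain ⟨J, hJ, hg⟩ := g.2
  obtain ⟨x, hx, hx0⟩ := hI.pull hp hJ hg
  have h0 : f.1 (g.1 x) = 0 := zero_of_π (f := f * g) (hf.mul hg) h hx
  obtain ⟨h1, h2⟩ := mem_pull.1 hx
  by_cases hgx : g.1 x = 0
  · exact Or.inr (π_zero_of hg h1 hx0 hgx)
  · exact Or.inl (π_zero_of hf h2 hgx h0)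

instance [Nontrivial R] (hp : IsPr R) : IsDomain (C k R hp) := NoZeroDivisors.to_isDomain _

lemma exists_prod (hp : IsPr R) [Nontrivial R] {I : TwoSidedIdeal R} (hI : NZ I) (n : ℕ) :
    ∃ x : Fin n → R, (∀ j, x j ∈ I) ∧ (List.ofFn x).prod ≠ 0 := by
  induction n with
  | zero => exact ⟨Fin.elim0, fun j => j.elim0, by simp⟩
  | succ n ih =>
    obtain ⟨x, hx, hx0⟩ := ih
    obtain ⟨e, he, he0⟩ := hI
    obtain ⟨r, hr⟩ := hp.ex he0 hx0
    refine ⟨Fin.cons (e * r) x, fun j => ?_, by simpa [List.ofFn_succ] using hr⟩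
    refine Fin.cases ?_ (fun j => ?_) j
    · simpa using I.mul_mem_right _ _ he
    · simpa using hx j

lemma C_alg [Nontrivial R] (hp : IsPr R) (halg : ExtCentroidAlgebraic k R) (a : C k R hp) :
    IsIntegral k a := by
  obtain ⟨f, rfl⟩ := π_surj hp a
  obtain ⟨I, hI, hf⟩ := f.2
  have hIb : I ≠ ⊥ := by
    rintro rfl
    obtain ⟨x, hx, hx0⟩ := hI
    exact hx0 hx
  obtain ⟨n, c, hn, ⟨i, hi⟩, h⟩ := halg I hIb f.1 (fun x _ y _ => map_add _ _ _)
    (fun c x _ => map_smul _ _ _) (fun r x hx => (hf x hx r).1) (fun r x hx => (hf x hx r).2)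
  let p : Polynomial k := ∑ i : Fin (n + 1), Polynomial.monomial (i : ℕ) (c i)
  have hp0 : p ≠ 0 := by
    intro h0
    apply hi
    have := congrArg (fun q => Polynomial.coeff q (i : ℕ)) h0
    simpa [p, Polynomial.finsetSum_coeff, Polynomial.coeff_monomial, Fin.val_inj] using this
  refine IsAlgebraic.isIntegral ⟨p, hp0, ?_⟩
  rw [Polynomial.aeval_algHom_apply]
  obtain ⟨D, hD, hq⟩ := (Polynomial.aeval f p).2
  obtain ⟨x, hx, hx0⟩ := exists_prod hp (hI.inf hp hD) n
  refine π_zero_of hq (x := (List.ofFn x).prod) ?_ hx0 ?_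
  · obtain ⟨m, rfl⟩ : ∃ m, n = m + 1 := ⟨n - 1, by omega⟩
    rw [List.ofFn_succ, List.prod_cons]
    exact D.mul_mem_right _ _ (hx 0).2
  · have := h x (fun j => (hx j).1)
    rw [← this]
    have e : (Polynomial.aeval f p : P k R hp).1 = Polynomial.aeval f.1 p :=
      (Polynomial.aeval_algHom_apply (P k R hp).val f p).symm
    rw [e]
    simp [p, Polynomial.aeval_monomial, Module.End.pow_apply, LinearMap.sum_apply,
      Algebra.algebraMap_eq_smul_one]

/-- A finite-dimensional space of classes has a common domain. -/
lemma common_dom [Nontrivial R] (hp : IsPr R) (t : Finset (C k R hp)) :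
    ∃ J : TwoSidedIdeal R, NZ J ∧ ∀ c ∈ Submodule.span k (t : Set (C k R hp)),
      ∃ h : P k R hp, π hp h = c ∧ HomOn J h.1 := by
  classical
  have key : ∃ J : TwoSidedIdeal R, NZ J ∧ ∀ c ∈ t,
      ∃ h : P k R hp, π hp h = c ∧ HomOn J h.1 := by
    induction t using Finset.induction_on with
    | empty => exact ⟨⊤, NZ.top, by simp⟩
    | insert a s ha ih =>
      obtain ⟨J, hJ, h⟩ := ih
      obtain ⟨f, hf⟩ := π_surj hp a
      obtain ⟨I, hI, hfI⟩ := f.2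
      refine ⟨I ⊓ J, hI.inf hp hJ, fun c hc => ?_⟩
      rcases Finset.mem_insert.1 hc with rfl | hc
      · exact ⟨f, hf, hfI.infl J⟩
      · obtain ⟨g, hg, hgJ⟩ := h c hc
        exact ⟨g, hg, hgJ.infr I⟩
  obtain ⟨J, hJ, h⟩ := key
  refine ⟨J, hJ, fun c hc => ?_⟩
  induction hc using Submodule.span_induction with
  | mem x hx => exact h x hx
  | zero => exact ⟨0, map_zero _, fun x hx r => by simp⟩
  | add x y _ _ hx hy =>
    obtain ⟨f, hf, hf'⟩ := hx
    obtain ⟨g, hg, hg'⟩ := hy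
    exact ⟨f + g, by rw [map_add, hf, hg], hf'.add hg'⟩
  | smul a x _ hx =>
    obtain ⟨f, hf, hf'⟩ := hx
    exact ⟨a • f, by rw [map_smul, hf], hf'.smul a⟩

/-- The multiplication algebra. -/
def M (k : Type) [Field k] (R : Type) [Ring R] [Algebra k R] : Subalgebra k (Module.End k R) :=
  Algebra.adjoin k (Set.range (LinearMap.mulLeft k (A := R)) ∪
    Set.range (LinearMap.mulRight k (A := R)))

lemma left_mem (a : R) : LinearMap.mulLeft k a ∈ M k R :=
  Algebra.subset_adjoin (Or.inl ⟨a, rfl⟩)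

lemma right_mem (a : R) : LinearMap.mulRight k a ∈ M k R :=
  Algebra.subset_adjoin (Or.inr ⟨a, rfl⟩)

lemma M_ideal (I : TwoSidedIdeal R) {φ : Module.End k R} (hφ : φ ∈ M k R) :
    ∀ v ∈ I, φ v ∈ I := by
  induction hφ using Algebra.adjoin_induction with
  | mem x hx =>
    intro v hv
    rcases hx with ⟨a, rfl⟩ | ⟨a, rfl⟩
    · exact I.mul_mem_left _ _ hv
    · exact I.mul_mem_right _ _ hv
  | algebraMap c =>
    intro v hv
    rw [Module.algebraMap_end_apply, Algebra.smul_def]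
    exact I.mul_mem_left _ _ hv
  | add x y _ _ hx hy => exact fun v hv => I.add_mem (hx v hv) (hy v hv)
  | mul x y _ _ hx hy => exact fun v hv => hx _ (hy v hv)

/-- The ideal generated by `v`. -/
def gen (k : Type) [Field k] {R : Type} [Ring R] [Algebra k R] (v : R) : TwoSidedIdeal R :=
  TwoSidedIdeal.mk' {x | ∃ φ ∈ M k R, φ v = x}
    ⟨0, zero_mem _, rfl⟩
    (by
      rintro _ _ ⟨φ, hφ, rfl⟩ ⟨ψ, hψ, rfl⟩
      exact ⟨φ + ψ, add_mem hφ hψ, rfl⟩)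
    (by
      rintro _ ⟨φ, hφ, rfl⟩
      exact ⟨-φ, neg_mem hφ, rfl⟩)
    (by
      rintro r _ ⟨φ, hφ, rfl⟩
      exact ⟨_, mul_mem (left_mem r) hφ, rfl⟩)
    (by
      rintro _ r ⟨φ, hφ, rfl⟩
      exact ⟨_, mul_mem (right_mem r) hφ, rfl⟩)

lemma mem_gen {v x : R} : x ∈ gen k v ↔ ∃ φ ∈ M k R, φ v = x := by
  unfold gen
  rw [TwoSidedIdeal.mem_mk']
  rfl

lemma exists_factor {A : Type} [AddCommGroup A] [Module k A] (e g : A →ₗ[k] R)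
    (h : ∀ a, e a = 0 → g a = 0) : ∃ f : Module.End k R, ∀ a, f (e a) = g a := by
  obtain ⟨s, hs⟩ := e.rangeRestrict.exists_rightInverse_of_surjective e.range_rangeRestrict
  obtain ⟨f, hf⟩ := LinearMap.exists_extend (g ∘ₗ s)
  refine ⟨f, fun a => ?_⟩
  have h1 : f (e a) = g (s (e.rangeRestrict a)) := congrArg (fun q => q (e.rangeRestrict a)) hf
  have h2 : e.rangeRestrict (s (e.rangeRestrict a)) = e.rangeRestrict a :=
    congrArg (fun q => q (e.rangeRestrict a)) hs
  have h3 : e (s (e.rangeRestrict a)) = e a := congrArg Subtype.val h2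
  rw [h1, ← sub_eq_zero, ← map_sub]
  exact h _ (by rw [map_sub, h3, sub_self])

lemma exists_fw (v w : R) (h : ∀ φ ∈ M k R, φ v = 0 → φ w = 0) :
    ∃ f : Module.End k R, HomOn (gen k v) f ∧ ∀ φ ∈ M k R, f (φ v) = φ w := by
  obtain ⟨f, hf⟩ := exists_factor (k := k) (A := M k R)
    ((LinearMap.applyₗ v) ∘ₗ (M k R).val.toLinearMap)
    ((LinearMap.applyₗ w) ∘ₗ (M k R).val.toLinearMap) (fun a ha => h a.1 a.2 ha)
  have hf' : ∀ φ ∈ M k R, f (φ v) = φ w := fun φ hφ => hf ⟨φ, hφ⟩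
  refine ⟨f, ?_, hf'⟩
  intro x hx r
  obtain ⟨φ, hφ, rfl⟩ := mem_gen.1 hx
  rw [hf' φ hφ]
  exact ⟨hf' _ (mul_mem (left_mem r) hφ), hf' _ (mul_mem (right_mem r) hφ)⟩

/-- The irreducible case. -/
lemma irred_case [Nontrivial R] (hp : IsPr R) (halg : ExtCentroidAlgebraic k R)
    (V : Submodule k R) (hfin : FiniteDimensional k V) (v : R) (hvV : v ∈ V) (hv : v ≠ 0)
    (h : ∀ φ ∈ M k R, φ v = 0 → ∀ w ∈ V, φ w = 0) :
    ∃ r : R, r ≠ 0 ∧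
      ∀ I : TwoSidedIdeal R, (∃ v : R, v ∈ I ∧ v ∈ V ∧ v ≠ 0) → r ∈ I := by
  classical
  have h1 : ∀ w : V, ∃ f : Module.End k R, HomOn (gen k v) f ∧ ∀ φ ∈ M k R, f (φ v) = φ w.1 :=
    fun w => exists_fw v w.1 fun φ hφ h0 => h φ hφ h0 _ w.2
  choose F hF hFv using h1
  have hvg : v ∈ gen k v := mem_gen.2 ⟨1, one_mem _, rfl⟩
  have hF1 : ∀ w, F w v = w.1 := fun w => hFv w 1 (one_mem _)
  let G : V → P k R hp := fun w => ⟨F w, gen k v, ⟨v, hvg, hv⟩, hF w⟩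
  let L : V →ₗ[k] C k R hp :=
    { toFun := fun w => π hp (G w)
      map_add' := fun x y => by
        rw [← sub_eq_zero, ← map_add, ← map_sub]
        refine π_zero_of (I := gen k v) (x := v) ((hF _).sub ((hF _).add (hF _))) hvg hv ?_
        change F (x + y) v - (F x v + F y v) = 0
        simp [hF1]
      map_smul' := fun c x => by
        rw [← sub_eq_zero, RingHom.id_apply, ← map_smul, ← map_sub]
        refine π_zero_of (I := gen k v) (x := v) ((hF _).sub ((hF _).smul c)) hvg hv ?_
        change F (c • x) v - c • F x v = 0
        simp [hF1] }
  obtain ⟨s, hs⟩ : (LinearMap.range L).FG := Module.Finite.iff_fg.1 inferInstance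
  let S := Algebra.adjoin k (s : Set (C k R hp))
  have hSfg : (Subalgebra.toSubmodule S).FG :=
    fg_adjoin_of_finite s.finite_toSet fun x _ => C_alg hp halg x
  obtain ⟨t, ht⟩ := hSfg
  have hLS : ∀ w, L w ∈ S := fun w => by
    have : L w ∈ Submodule.span k (s : Set (C k R hp)) := by rw [hs]; exact ⟨w, rfl⟩
    exact Algebra.span_le_adjoin k _ this
  have hSint : Algebra.IsIntegral k S := ⟨fun x =>
    (isIntegral_algHom_iff S.val Subtype.val_injective).1 (C_alg hp halg x.1)⟩
  have hSF : IsField S := isField_of_isIntegral_of_isField' (Field.toIsField k)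
  obtain ⟨J, ⟨y, hy, hy0⟩, hJ⟩ := common_dom hp t
  obtain ⟨q, hq⟩ := hp.ex hy0 hv
  refine ⟨y * q * v, hq, ?_⟩
  rintro I ⟨w, hwI, hwV, hw0⟩
  have hL0 : (⟨L ⟨w, hwV⟩, hLS _⟩ : S) ≠ 0 := by
    intro h0
    have h0 : π hp (G ⟨w, hwV⟩) = 0 := congrArg Subtype.val h0
    have := zero_of_π (hF _) h0 hvg
    exact hw0 ((hF1 ⟨w, hwV⟩).symm.trans this)
  obtain ⟨b, hb⟩ := hSF.mul_inv_cancel hL0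
  have hb : π hp (G ⟨w, hwV⟩) * b.1 = 1 := congrArg Subtype.val hb
  obtain ⟨g, hgb, hg⟩ := hJ b.1 (by rw [ht]; exact b.2)
  rw [← hgb, ← map_one (π hp), ← sub_eq_zero, ← map_mul, ← map_sub] at hb
  have hyJ : y * q * v ∈ J := J.mul_mem_right _ _ (J.mul_mem_right _ _ hy)
  have hgv : g.1 (y * q * v) ∈ gen k v := by
    rw [(hg _ (J.mul_mem_right _ q hy) v).2]
    exact (gen k v).mul_mem_left _ _ hvg
  have hz := zero_of_π (f := G ⟨w, hwV⟩ * g - 1) (x := y * q * v)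
    (((hF ⟨w, hwV⟩).mul hg).sub (HomOn.one _)) hb (mem_pull.2 ⟨hyJ, hgv⟩)
  have hz : F ⟨w, hwV⟩ (g.1 (y * q * v)) - y * q * v = 0 := hz
  obtain ⟨φ, hφ, hφv⟩ := mem_gen.1 hgv
  rw [← hφv, hFv _ φ hφ, sub_eq_zero] at hz
  rw [← hz]
  exact M_ideal I hφ w hwI

lemma main [Nontrivial R] (hp : IsPr R) (halg : ExtCentroidAlgebraic k R) (n : ℕ) :
    ∀ V : Submodule k R, V ≠ ⊥ → FiniteDimensional k V → Module.finrank k V = n →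
    ∃ r : R, r ≠ 0 ∧
      ∀ I : TwoSidedIdeal R, (∃ v : R, v ∈ I ∧ v ∈ V ∧ v ≠ 0) → r ∈ I := by
  induction n using Nat.strong_induction_on with
  | _ n ih =>
  intro V hV hfin hn
  obtain ⟨v, hvV, hv⟩ := Submodule.exists_mem_ne_zero_of_ne_bot hV
  by_cases h : ∀ φ ∈ M k R, φ v = 0 → ∀ w ∈ V, φ w = 0
  · exact irred_case hp halg V hfin v hvV hv h
  push Not at h
  obtain ⟨φ, hφ, hφv, w, hwV, hφw⟩ := h
  have hlt1 : V ⊓ LinearMap.ker φ < V :=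
    lt_of_le_of_ne inf_le_left fun he => hφw (by
      have : w ∈ V ⊓ LinearMap.ker φ := by rw [he]; exact hwV
      exact this.2)
  have hlt2 : Module.finrank k (V.map φ) < n := by
    have e := LinearMap.finrank_range_add_finrank_ker (φ.domRestrict V)
    rw [LinearMap.range_domRestrict, hn] at e
    have : 0 < Module.finrank k (LinearMap.ker (φ.domRestrict V)) := by
      have : Nontrivial (LinearMap.ker (φ.domRestrict V)) := by
        refine ⟨⟨⟨v, hvV⟩, hφv⟩, 0, fun h0 => hv ?_⟩
        exact congrArg (fun z => z.1.1) h0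
      exact Module.finrank_pos (R := k) (M := LinearMap.ker (φ.domRestrict V))
    omega
  obtain ⟨r1, hr1, H1⟩ := ih _ (hn ▸ Submodule.finrank_lt_finrank_of_lt hlt1)
    (V ⊓ LinearMap.ker φ) (Submodule.ne_bot_iff _ |>.2 ⟨v, ⟨hvV, hφv⟩, hv⟩)
    (Submodule.finiteDimensional_inf_left _ _) rfl
  obtain ⟨r2, hr2, H2⟩ := ih _ hlt2 (V.map φ)
    (Submodule.ne_bot_iff _ |>.2 ⟨φ w, ⟨w, hwV, rfl⟩, hφw⟩) inferInstance rfl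
  obtain ⟨x, hx⟩ := hp.ex hr1 hr2
  refine ⟨r1 * x * r2, hx, ?_⟩
  rintro I ⟨u, huI, huV, hu0⟩
  by_cases hu : φ u = 0
  · exact I.mul_mem_right _ _ (I.mul_mem_right _ _ (H1 I ⟨u, huI, ⟨huV, hu⟩, hu0⟩))
  · exact I.mul_mem_left _ _ (H2 I ⟨φ u, M_ideal I hφ u huI, ⟨u, huV, rfl⟩, hu⟩)

end ExtCent

/-- If `R` is a prime `k`-algebra whose extended centroid is
algebraic over `k`, and `V` is a nonzero finite-dimensional subspace of `R`,
then there is a nonzero `r ∈ R` lying in every two-sided ideal `I` with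
`I ∩ V ≠ 0`. -/
theorem exists_common_element_of_ideals_meeting_subspace
    (k : Type) [Field k] (R : Type) [Ring R] [Algebra k R]
    (hprime : ∀ a b : R, (∀ x : R, a * x * b = 0) → a = 0 ∨ b = 0)
    (halg : ExtCentroidAlgebraic k R)
    (V : Submodule k R) (hV : V ≠ ⊥) (hfin : FiniteDimensional k V) :
    ∃ r : R, r ≠ 0 ∧
      ∀ I : TwoSidedIdeal R, (∃ v : R, v ∈ I ∧ v ∈ V ∧ v ≠ 0) → r ∈ I := by
  obtain ⟨v, _, hv⟩ := Submodule.exists_mem_ne_zero_of_ne_bot hV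
  have : Nontrivial R := ⟨v, 0, hv⟩
  exact ExtCent.main hprime halg _ V hV hfin rfl
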